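/- Let X be a locally finite preordered set with equivalence classes C_i under ~ finite. The coradical of C = IC(X) (the socle of C as a right C-comodule, equivalently the sum of all simple subcoalgebras) equals Σ_i D_i, where D_i = span{e_{x,y} : x,y ∈ C_i}. -/

import Mathlib

open TensorProduct

/-- The underlying vector space of the incidence coalgebra `IC(X)`:
functions with finite support on the set of pairs `(x, y)` with `x ≤ y`. -/
abbrev IC (k X : Type*) [Field k] [Preorder X] : Type _ :=
  {p : X × X // p.1 ≤ p.2} →₀ k

/-- The basis element `e_{x,y}` of the incidence coalgebra. -/
noncomputable def e (k : Type*) {X : Type*} [Field k] [Preorder X] (x y : X) (h : x ≤ y) :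
    IC k X :=
  Finsupp.single ⟨(x, y), h⟩ 1

/-- The comultiplication `Δ(e_{x,y}) = Σ_{x ≤ z ≤ y} e_{x,z} ⊗ e_{z,y}`. -/
noncomputable def Δ (k : Type*) {X : Type*} [Field k] [Preorder X] [LocallyFiniteOrder X] :
    IC k X →ₗ[k] IC k X ⊗[k] IC k X :=
  Finsupp.lsum k fun p => LinearMap.toSpanSingleton k _
    (∑ z ∈ (Finset.Icc p.1.1 p.1.2).attach,
      e k p.1.1 z.1 (Finset.mem_Icc.mp z.2).1 ⊗ₜ[k] e k z.1 p.1.2 (Finset.mem_Icc.mp z.2).2)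

open Classical in
/-- The counit `ε(e_{x,y}) = δ_{x,y}`. -/
noncomputable def ε (k : Type*) {X : Type*} [Field k] [Preorder X] : IC k X →ₗ[k] k :=
  Finsupp.lsum k fun p => LinearMap.toSpanSingleton k k (if p.1.1 = p.1.2 then 1 else 0)

/-- The left action of `C* = Module.Dual k (IC k X)` on `C = IC k X` induced by the right
comodule structure: `c* → c = Σ c*(c₂) c₁`. -/
noncomputable def act (k : Type*) {X : Type*} [Field k] [Preorder X] [LocallyFiniteOrder X]
    (f : Module.Dual k (IC k X)) : IC k X →ₗ[k] IC k X :=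
  (TensorProduct.rid k (IC k X)).toLinearMap ∘ₗ TensorProduct.map LinearMap.id f ∘ₗ Δ k

/-- The right action of `C*` on `C`: `c ← c* = Σ c*(c₁) c₂`. -/
noncomputable def actR (k : Type*) {X : Type*} [Field k] [Preorder X] [LocallyFiniteOrder X]
    (f : Module.Dual k (IC k X)) : IC k X →ₗ[k] IC k X :=
  (TensorProduct.lid k (IC k X)).toLinearMap ∘ₗ TensorProduct.map f LinearMap.id ∘ₗ Δ k

/-- The dual basis functional `p_{x,y}`. -/
noncomputable def pfun (k : Type*) {X : Type*} [Field k] [Preorder X] (x y : X) (h : x ≤ y) :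
    Module.Dual k (IC k X) :=
  Finsupp.lapply ⟨(x, y), h⟩

/-- A subspace `D ⊆ IC(X)` is a subcoalgebra if `Δ(D) ⊆ D ⊗ D`. -/
def IsSubcoalgebra (k : Type*) {X : Type*} [Field k] [Preorder X] [LocallyFiniteOrder X]
    (D : Submodule k (IC k X)) : Prop :=
  ∀ c ∈ D, Δ k c ∈ LinearMap.range (TensorProduct.map D.subtype D.subtype)

/-- A subcoalgebra is simple if it is nonzero and has no nonzero proper subcoalgebras. -/
def IsSimpleSubcoalgebra (k : Type*) {X : Type*} [Field k] [Preorder X] [LocallyFiniteOrder X]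
    (D : Submodule k (IC k X)) : Prop :=
  IsSubcoalgebra k D ∧ D ≠ ⊥ ∧
    ∀ N : Submodule k (IC k X), N ≤ D → IsSubcoalgebra k N → N = ⊥ ∨ N = D

/-- The coradical of `IC(X)`: the sum of all its simple subcoalgebras. -/
noncomputable def coradical (k X : Type*) [Field k] [Preorder X] [LocallyFiniteOrder X] :
    Submodule k (IC k X) :=
  sSup {D : Submodule k (IC k X) | IsSimpleSubcoalgebra k D}

/-- The span of the `e_{x,y}` with `x, y` in the class of `a`. -/
noncomputable def DD (k : Type*) {X : Type*} [Field k] [Preorder X] (a : X) : Submodule k (IC k X) :=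
  Submodule.span k
      {c | ∃ (x y : X) (h : x ≤ y), AntisymmRel (· ≤ ·) x a ∧ AntisymmRel (· ≤ ·) y a ∧
        c = e k x y h}

section helpers
variable {k X : Type*} [Field k] [Preorder X] [LocallyFiniteOrder X]

lemma Δ_e (x y : X) (h : x ≤ y) : Δ k (e k x y h) =
    ∑ z ∈ (Finset.Icc x y).attach,
      e k x z.1 (Finset.mem_Icc.mp z.2).1 ⊗ₜ[k] e k z.1 y (Finset.mem_Icc.mp z.2).2 := by
  simp [Δ, e]

lemma act_mem {D : Submodule k (IC k X)} (hD : IsSubcoalgebra k D) (f : Module.Dual k (IC k X))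
    {c : IC k X} (hc : c ∈ D) : act k f c ∈ D := by
  obtain ⟨t, ht⟩ := hD c hc
  simp only [act, LinearMap.comp_apply, ← ht]
  clear ht
  induction t using TensorProduct.induction_on with
  | zero => simp
  | tmul a b => simpa using D.smul_mem _ a.2
  | add a b ha hb => simpa only [map_add] using D.add_mem ha hb

lemma actR_mem {D : Submodule k (IC k X)} (hD : IsSubcoalgebra k D) (f : Module.Dual k (IC k X))
    {c : IC k X} (hc : c ∈ D) : actR k f c ∈ D := by
  obtain ⟨t, ht⟩ := hD c hc
  simp only [actR, LinearMap.comp_apply, ← ht]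
  clear ht
  induction t using TensorProduct.induction_on with
  | zero => simp
  | tmul a b => simpa using D.smul_mem _ b.2
  | add a b ha hb => simpa only [map_add] using D.add_mem ha hb

lemma act_e (f : Module.Dual k (IC k X)) (x y : X) (h : x ≤ y) : act k f (e k x y h) =
    ∑ z ∈ (Finset.Icc x y).attach,
      f (e k z.1 y (Finset.mem_Icc.mp z.2).2) • e k x z.1 (Finset.mem_Icc.mp z.2).1 := by
  simp [act, Δ_e, map_sum]

lemma actR_e (f : Module.Dual k (IC k X)) (x y : X) (h : x ≤ y) : actR k f (e k x y h) =
    ∑ z ∈ (Finset.Icc x y).attach,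
      f (e k x z.1 (Finset.mem_Icc.mp z.2).1) • e k z.1 y (Finset.mem_Icc.mp z.2).2 := by
  simp [actR, Δ_e, map_sum]

open Classical in
lemma pfun_e (x y u v : X) (h : x ≤ y) (h' : u ≤ v) :
    pfun k x y h (e k u v h') = if u = x ∧ v = y then 1 else 0 := by
  simp [pfun, e, Finsupp.single_apply]

lemma act_pfun_ne (z w x y : X) (hzw : z ≤ w) (h : x ≤ y) (hy : y ≠ w) :
    act k (pfun k z w hzw) (e k x y h) = 0 := by
  rw [act_e]
  exact Finset.sum_eq_zero fun u _ => by simp [pfun_e, hy]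

lemma act_pfun_eq (z x y : X) (hxz : x ≤ z) (hzy : z ≤ y) :
    act k (pfun k z y hzy) (e k x y (hxz.trans hzy)) = e k x z hxz := by
  rw [act_e, Finset.sum_eq_single ⟨z, Finset.mem_Icc.mpr ⟨hxz, hzy⟩⟩]
  · simp [pfun_e]
  · rintro ⟨u, hu⟩ _ hne
    have : u ≠ z := fun h => hne (Subtype.ext h)
    simp [pfun_e, this]
  · simp

lemma actR_pfun_ne (z w x y : X) (hzw : z ≤ w) (h : x ≤ y) (hx : x ≠ z) :
    actR k (pfun k z w hzw) (e k x y h) = 0 := by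
  rw [actR_e]
  exact Finset.sum_eq_zero fun u _ => by simp [pfun_e, hx]

lemma actR_pfun_eq (z x y : X) (hxz : x ≤ z) (hzy : z ≤ y) :
    actR k (pfun k x z hxz) (e k x y (hxz.trans hzy)) = e k z y hzy := by
  rw [actR_e, Finset.sum_eq_single ⟨z, Finset.mem_Icc.mpr ⟨hxz, hzy⟩⟩]
  · simp [pfun_e]
  · rintro ⟨u, hu⟩ _ hne
    have : u ≠ z := fun h => hne (Subtype.ext h)
    simp [pfun_e, this]
  · simp

lemma corner (x y : X) (h : x ≤ y) (c : IC k X) :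
    actR k (pfun k x x le_rfl) (act k (pfun k y y le_rfl) c) = c ⟨(x, y), h⟩ • e k x y h := by
  induction c using Finsupp.induction_linear with
  | zero => simp
  | add f g hf hg => simp only [map_add, hf, hg, Finsupp.add_apply, add_smul]
  | single p r =>
    obtain ⟨⟨u, v⟩, huv⟩ := p
    have hs : (Finsupp.single ⟨(u, v), huv⟩ r : IC k X) = r • e k u v huv := by simp [e]
    rw [hs, map_smul, map_smul]
    by_cases hv : v = y
    · subst hv
      rw [act_pfun_eq v u v huv le_rfl]
      by_cases hu : u = x
      · subst hu
        rw [actR_pfun_eq u u v le_rfl huv]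
        simp [e]
      · rw [actR_pfun_ne _ _ _ _ _ _ hu]
        simp [e, hu]
    · rw [act_pfun_ne _ _ _ _ _ _ hv]
      simp [e, hv]

lemma exists_DD_le {D : Submodule k (IC k X)} (hD : IsSubcoalgebra k D) (h0 : D ≠ ⊥) :
    ∃ a, DD k a ≤ D := by
  obtain ⟨c, hc, hc0⟩ := D.ne_bot_iff.mp h0
  obtain ⟨⟨⟨x, y⟩, h⟩, hp⟩ := Finsupp.ne_iff.mp hc0
  have h1 : c ⟨(x, y), h⟩ • e k x y h ∈ D := by
    rw [← corner]; exact actR_mem hD _ (act_mem hD _ hc)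
  have h2 : e k x y h ∈ D := (D.smul_mem_iff hp).mp h1
  have h3 : e k x x le_rfl ∈ D := by
    rw [← act_pfun_eq (k := k) x x y le_rfl h]; exact act_mem hD _ h2
  refine ⟨x, Submodule.span_le.mpr ?_⟩
  rintro _ ⟨u, v, huv, hu, hv, rfl⟩
  have h4 : e k x v hv.2 ∈ D := by
    rw [← act_pfun_eq (k := k) v x x hv.2 hv.1]; exact act_mem hD _ h3
  rw [← actR_pfun_eq (k := k) u x v hu.2 huv]
  exact actR_mem hD _ h4

lemma e_mem_DD (a : X) : e k a a le_rfl ∈ DD k a :=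
  Submodule.subset_span ⟨a, a, le_rfl, AntisymmRel.refl _ a, AntisymmRel.refl _ a, rfl⟩

lemma DD_ne_bot (a : X) : DD k a ≠ ⊥ := by
  intro h
  have := e_mem_DD (k := k) a
  rw [h, Submodule.mem_bot] at this
  simp [e] at this

lemma rel_of_mem {a x : X} (h : e k x x le_rfl ∈ DD k a) : AntisymmRel (· ≤ ·) x a := by
  by_contra hn
  have : DD k a ≤ LinearMap.ker (pfun k x x le_rfl) := by
    refine Submodule.span_le.mpr ?_
    rintro _ ⟨u, v, huv, hu, hv, rfl⟩
    have : u ≠ x := by rintro rfl; exact hn hu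
    simp [pfun_e, this]
  have := this h
  simp [pfun_e] at this

lemma DD_sub (a : X) : IsSubcoalgebra k (DD k a) := by
  suffices DD k a ≤ (LinearMap.range
      (TensorProduct.map (DD k a).subtype (DD k a).subtype)).comap (Δ k) from fun c hc => this hc
  refine Submodule.span_le.mpr ?_
  rintro _ ⟨u, v, huv, hu, hv, rfl⟩
  simp only [SetLike.mem_coe, Submodule.mem_comap, Δ_e]
  refine Submodule.sum_mem _ fun z _ => ?_
  have hz := Finset.mem_Icc.mp z.2
  have hza : AntisymmRel (· ≤ ·) z.1 a := ⟨hz.2.trans hv.1, hu.2.trans hz.1⟩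
  exact ⟨(⟨_, Submodule.subset_span ⟨u, z.1, hz.1, hu, hza, rfl⟩⟩ : DD k a) ⊗ₜ
    (⟨_, Submodule.subset_span ⟨z.1, v, hz.2, hza, hv, rfl⟩⟩ : DD k a), by simp⟩

lemma DD_le_of_rel {a b : X} (h : AntisymmRel (· ≤ ·) a b) : DD k a ≤ DD k b := by
  refine Submodule.span_mono ?_
  rintro _ ⟨u, v, huv, hu, hv, rfl⟩
  exact ⟨u, v, huv, hu.trans h, hv.trans h, rfl⟩

lemma DD_simple (a : X) : IsSimpleSubcoalgebra k (DD k a) := by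
  refine ⟨DD_sub a, DD_ne_bot a, fun N hN hs => ?_⟩
  by_cases h0 : N = ⊥
  · exact Or.inl h0
  · obtain ⟨x, hx⟩ := exists_DD_le hs h0
    exact Or.inr (le_antisymm hN
      ((DD_le_of_rel (rel_of_mem (hN (hx (e_mem_DD x)))).symm).trans hx))

end helpers

/-- If the `~`-equivalence classes of a locally finite preordered set `X`
are finite, the coradical of `C = IC(X)` equals `Σ_i D_i`, where `D_i` is the span of the
`e_{x,y}` with `x, y` in the `i`-th equivalence class (here indexed by representatives). -/
theorem statement15 (k X : Type*) [Field k] [Preorder X] [LocallyFiniteOrder X]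
    (hfin : ∀ x : X, {y : X | x ≤ y ∧ y ≤ x}.Finite) :
    coradical k X = ⨆ a : X, Submodule.span k
      {c | ∃ (x y : X) (h : x ≤ y), AntisymmRel (· ≤ ·) x a ∧ AntisymmRel (· ≤ ·) y a ∧
        c = e k x y h} := by
  change coradical k X = ⨆ a : X, DD k a
  apply le_antisymm
  · refine sSup_le fun D hD => ?_
    obtain ⟨a, ha⟩ := exists_DD_le hD.1 hD.2.1
    rcases hD.2.2 _ ha (DD_sub a) with h | h
    · exact absurd h (DD_ne_bot a)
    · rw [← h]; exact le_iSup (fun a => DD k a) a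
  · exact iSup_le fun a => le_sSup (DD_simple a)
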